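/- Let G be a countable group and μ a probability measure on G with finite entropy H(μ). Then for P-almost every sample path (xₙ) of the random walk (G,μ), the limit limₙ (1/n) log μ^{*n}(xₙ) exists and equals −h(μ); moreover, the convergence also holds in L¹(P). -/

import Mathlib

open MeasureTheory Filter Real Topology ENNReal

/-- Position of the random walk after `n` steps: `x n = h 1 ⋯ h n`, where `h : ℕ → G` is the
sequence of increments (`h i` being the `(i+1)`-st increment); `x 0 = e`. -/
def rwPos {G : Type*} [Group G] (h : ℕ → G) (n : ℕ) : G :=
  ((List.range n).map h).prod

/-- Convolution of two (sub-probability) densities on `G`: `(f * g)(x) = ∑_h f(h) g(h⁻¹ x)`. -/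
noncomputable def fconv {G : Type*} [Group G] (f g : G → ℝ≥0∞) : G → ℝ≥0∞ :=
  fun x => ∑' h : G, f h * g (h⁻¹ * x)

open scoped Classical in
/-- `n`-fold convolution power of a density, with `f^{*0} = δ_e`. -/
noncomputable def fconvPow {G : Type*} [Group G] (f : G → ℝ≥0∞) : ℕ → G → ℝ≥0∞
  | 0 => fun x => if x = 1 then 1 else 0
  | n + 1 => fconv (fconvPow f n) f

/-- Entropy of a (sub-)probability density on a countable group:
`H(f) = -∑_g f(g) log f(g)`. -/
noncomputable def fent {G : Type*} (f : G → ℝ≥0∞) : ℝ :=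
  -∑' g : G, (f g).toReal * Real.log (f g).toReal

/-- A subadditive array `a i n` (the cost of the window of length `n` starting at `i`) is bounded
along `q` consecutive windows of length `m` by the sum of their costs. -/
theorem subadditive_array_le_sum_blocks {M : Type*} [AddCommMonoid M] [PartialOrder M]
    [IsOrderedAddMonoid M] {a : ℕ → ℕ → M} (h0 : ∀ i, a i 0 = 0)
    (hsub : ∀ i m n, a i (m + n) ≤ a i m + a (i + m) n) (m i q : ℕ) :
    a i (m * q) ≤ ∑ k ∈ Finset.range q, a (i + m * k) m := by
  induction q with
  | zero => simp [h0]
  | succ q ih =>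
    rw [Finset.sum_range_succ, Nat.mul_succ]
    exact (hsub i (m * q) m).trans (by gcongr)

theorem subadditive_array_le_sum {M : Type*} [AddCommMonoid M] [PartialOrder M]
    [IsOrderedAddMonoid M] {a : ℕ → ℕ → M} (h0 : ∀ i, a i 0 = 0)
    (hsub : ∀ i m n, a i (m + n) ≤ a i m + a (i + m) n) (i n : ℕ) :
    a i n ≤ ∑ k ∈ Finset.range n, a (i + k) 1 := by
  simpa using subadditive_array_le_sum_blocks h0 hsub 1 i n

/-- Greedy covering: if from every starting point some window of length at most `M` has cost at
most the sum of the weights `φ` over it, then so has every window, up to its last `M` points. -/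
theorem subadditive_array_le_sum_of_covering {a : ℕ → ℕ → ℝ≥0∞} (h0 : ∀ i, a i 0 = 0)
    (hsub : ∀ i m n, a i (m + n) ≤ a i m + a (i + m) n) {φ : ℕ → ℝ≥0∞} {M : ℕ}
    (hcov : ∀ i, ∃ k, 1 ≤ k ∧ k ≤ M ∧ a i k ≤ ∑ j ∈ Finset.range k, φ (i + j)) (n i : ℕ) :
    a i n ≤ ∑ j ∈ Finset.range n, (φ (i + j) + if n ≤ j + M then a (i + j) 1 else 0) := by
  induction n using Nat.strong_induction_on generalizing i with
  | _ n ih =>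
    obtain ⟨k, hk1, hkM, hk⟩ := hcov i
    rcases lt_or_ge n k with hnk | hkn
    · refine (subadditive_array_le_sum h0 hsub i n).trans (Finset.sum_le_sum fun j _ => ?_)
      rw [if_pos (by omega)]
      exact le_add_self
    · obtain ⟨r, rfl⟩ := Nat.exists_eq_add_of_le hkn
      rw [Finset.sum_range_add]
      refine (hsub i k r).trans (add_le_add ?_ ?_)
      · exact hk.trans (Finset.sum_le_sum fun j _ => le_self_add)
      · refine (ih r (by omega) (i + k)).trans (Finset.sum_le_sum fun j _ => ?_)
        simp only [add_assoc, Nat.add_le_add_iff_left]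
        exact le_rfl

/-- The lower growth rate of a subadditive array does not decrease along the orbit. -/
theorem liminf_subadditive_array_le_succ {a : ℕ → ℕ → ℝ≥0∞}
    (hsub : ∀ i m n, a i (m + n) ≤ a i m + a (i + m) n) (i : ℕ) (hfin : a i 1 ≠ ⊤) :
    liminf (fun n : ℕ => a i n / n) atTop ≤ liminf (fun n : ℕ => a (i + 1) n / n) atTop := by
  refine le_of_forall_gt fun c hc => ?_
  obtain ⟨d, hd, hdc⟩ := exists_between hc
  obtain ⟨e, he0, hed⟩ : ∃ e : ℝ≥0∞, 0 < e ∧ d + e < c := by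
    obtain ⟨c', hdc', hc'⟩ := exists_between hdc
    exact ⟨c' - d, tsub_pos_of_lt hdc', by rwa [add_tsub_cancel_of_le hdc'.le]⟩
  refine lt_of_le_of_lt ?_ hed
  have hsmall : ∀ᶠ n : ℕ in atTop, a i 1 / (n : ℝ≥0∞) < e := by
    have : Tendsto (fun n : ℕ => a i 1 / (n : ℝ≥0∞)) atTop (𝓝 0) := by
      simpa [div_eq_mul_inv] using
        ENNReal.Tendsto.const_mul ENNReal.tendsto_inv_nat_nhds_zero (Or.inr hfin)
    exact this.eventually_lt_const he0
  have hfreq := (frequently_lt_of_liminf_lt (by isBoundedDefault) hd).and_eventually hsmall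
  refine liminf_le_of_frequently_le' ((tendsto_add_atTop_nat 1).frequently
    (p := fun n : ℕ => a i n / n ≤ d + e) (hfreq.mono fun n hn => ?_))
  calc a i (n + 1) / ((n + 1 : ℕ) : ℝ≥0∞)
      ≤ (a i 1 + a (i + 1) n) / ((n + 1 : ℕ) : ℝ≥0∞) := by
        gcongr
        simpa [add_comm] using hsub i 1 n
    _ ≤ (a i 1 + a (i + 1) n) / (n : ℝ≥0∞) := by
        gcongr
        simp
    _ = a (i + 1) n / n + a i 1 / n := by rw [ENNReal.add_div, add_comm]
    _ ≤ d + e := add_le_add hn.1.le hn.2.le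

theorem ENNReal.le_of_forall_natCast_mul_le_add {x a b : ℝ≥0∞} (hb : b ≠ ⊤)
    (h : ∀ n : ℕ, n * x ≤ n * a + b) : x ≤ a := by
  have hlim : Tendsto (fun n : ℕ => a + b / (n : ℝ≥0∞)) atTop (𝓝 a) := by
    have : Tendsto (fun n : ℕ => b / (n : ℝ≥0∞)) atTop (𝓝 0) := by
      simpa [div_eq_mul_inv] using
        ENNReal.Tendsto.const_mul ENNReal.tendsto_inv_nat_nhds_zero (Or.inr hb)
    simpa using tendsto_const_nhds.add this
  refine ge_of_tendsto hlim ((eventually_gt_atTop 0).mono fun n hn => ?_)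
  have hn0 : (n : ℝ≥0∞) ≠ 0 := by exact_mod_cast hn.ne'
  have := ENNReal.div_le_div_right (h n) n
  rwa [ENNReal.add_div, mul_comm, ENNReal.mul_div_cancel_right hn0 (by simp), mul_comm,
    ENNReal.mul_div_cancel_right hn0 (by simp)] at this

theorem ae_forall_iterate {Ω : Type*} [MeasurableSpace Ω] {P : Measure Ω} {T : Ω → Ω}
    (hT : MeasurePreserving T P P) {p : Ω → Prop} (hp : ∀ᵐ ω ∂P, p ω) :
    ∀ᵐ ω ∂P, ∀ i, p (T^[i] ω) :=
  ae_all_iff.2 fun i => (hT.iterate i).quasiMeasurePreserving.ae hp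

theorem sum_range_ite_le_add_le {M : ℕ} (b : ℝ≥0∞) (n : ℕ) :
    ∑ j ∈ Finset.range n, (if n ≤ j + M then b else 0) ≤ M * b := by
  rw [← Finset.sum_filter, Finset.sum_const, nsmul_eq_mul]
  gcongr
  calc _ ≤ (Finset.Ico (n - M) n).card := Finset.card_le_card fun j hj => by
        simp only [Finset.mem_filter, Finset.mem_range, Finset.mem_Ico] at hj ⊢
        omega
    _ ≤ M := by simp; omega

/-- Lower half of Kingman's theorem: the mean growth rate of a subadditive process is at most the
mean of its pathwise lower growth rate. -/
theorem le_lintegral_liminf_of_subadditive {Ω : Type*} [MeasurableSpace Ω] {P : Measure Ω}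
    [IsProbabilityMeasure P] {T : Ω → Ω} (hT : MeasurePreserving T P P) {F : ℕ → Ω → ℝ≥0∞}
    (hF : ∀ n, Measurable (F n)) (h0 : ∀ ω, F 0 ω = 0) (hfin : ∀ ω, F 1 ω ≠ ⊤)
    (hint : ∫⁻ ω, F 1 ω ∂P ≠ ⊤)
    (hsub : ∀ᵐ ω ∂P, ∀ m n, F (m + n) ω ≤ F m ω + F n (T^[m] ω))
    {x : ℝ≥0∞} (hx : ∀ n : ℕ, n * x ≤ ∫⁻ ω, F n ω ∂P) :
    x ≤ ∫⁻ ω, liminf (fun n : ℕ => F n ω / n) atTop ∂P := by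
  set g : Ω → ℝ≥0∞ := fun ω => liminf (fun n : ℕ => F n ω / n) atTop
  have hgm : Measurable g := Measurable.liminf fun n => (hF n).div_const _
  set A : ENNReal → ℕ → Set Ω := fun ε M => {ω | ∀ k, 1 ≤ k → k ≤ M → k * (g ω + ε) < F k ω}
  have hAm : ∀ ε M, MeasurableSet (A ε M) := fun ε M => by
    have : A ε M = ⋂ k : ℕ, ⋂ _ : 1 ≤ k, ⋂ _ : k ≤ M, {ω | k * (g ω + ε) < F k ω} := by
      ext; simp [A]
    rw [this]
    exact MeasurableSet.iInter fun k => MeasurableSet.iInter fun _ => MeasurableSet.iInter fun _ =>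
      measurableSet_lt ((hgm.add_const _).const_mul _) (hF k)
  have hsub' := ae_forall_iterate hT hsub
  have key : ∀ ε M, 1 ≤ M → x ≤ ∫⁻ ω, g ω ∂P + ε + ∫⁻ ω in A ε M, F 1 ω ∂P := by
    intro ε M hM
    set φ : Ω → ℝ≥0∞ := fun ω => g ω + ε + (A ε M).indicator (F 1) ω
    have hφm : Measurable φ := (hgm.add_const _).add ((hF 1).indicator (hAm ε M))
    have hφ : ∫⁻ ω, φ ω ∂P = ∫⁻ ω, g ω ∂P + ε + ∫⁻ ω in A ε M, F 1 ω ∂P := by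
      rw [lintegral_add_left (hgm.add_const _), lintegral_add_left hgm, lintegral_const,
        measure_univ, mul_one, lintegral_indicator (hAm ε M)]
    rw [← hφ]
    refine ENNReal.le_of_forall_natCast_mul_le_add (b := M * ∫⁻ ω, F 1 ω ∂P)
      (ENNReal.mul_ne_top (by simp) hint) fun n => ?_
    have hpath : ∀ᵐ ω ∂P, F n ω ≤ ∑ j ∈ Finset.range n,
        (φ (T^[j] ω) + if n ≤ j + M then F 1 (T^[j] ω) else 0) := by
      filter_upwards [hsub'] with ω hω
      have hs : ∀ i m n, F (m + n) (T^[i] ω) ≤ F m (T^[i] ω) + F n (T^[i + m] ω) :=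
        fun i m n => by simpa [add_comm i m, Function.iterate_add_apply] using hω i m n
      have hmono : Monotone fun i => g (T^[i] ω) := monotone_nat_of_le_succ fun i =>
        liminf_subadditive_array_le_succ (a := fun i n => F n (T^[i] ω)) hs i (hfin _)
      have := subadditive_array_le_sum_of_covering (a := fun i n => F n (T^[i] ω))
        (fun i => h0 _) hs (φ := fun i => φ (T^[i] ω)) (M := M) (fun i => ?_) n 0
      · simpa using this
      · by_cases hi : T^[i] ω ∈ A ε M
        · exact ⟨1, le_rfl, hM, by simp [φ, hi]⟩
        · simp only [A, Set.mem_ofPred_eq, not_forall, not_lt] at hi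
          obtain ⟨k, hk1, hkM, hk⟩ := hi
          refine ⟨k, hk1, hkM, hk.trans ?_⟩
          rw [← nsmul_eq_mul, ← Finset.card_range k, ← Finset.sum_const, Finset.card_range]
          refine Finset.sum_le_sum fun j _ => le_trans ?_ le_self_add
          gcongr
          exact hmono (Nat.le_add_right i j)
    have hcomp : ∀ (f : Ω → ℝ≥0∞), Measurable f → ∀ j, ∫⁻ ω, f (T^[j] ω) ∂P = ∫⁻ ω, f ω ∂P :=
      fun f hf j => (hT.iterate j).lintegral_comp hf
    have hTm : ∀ j, Measurable T^[j] := fun j => (hT.iterate j).measurable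
    calc n * x ≤ ∫⁻ ω, F n ω ∂P := hx n
      _ ≤ ∫⁻ ω, ∑ j ∈ Finset.range n,
          (φ (T^[j] ω) + if n ≤ j + M then F 1 (T^[j] ω) else 0) ∂P := lintegral_mono_ae hpath
      _ = ∑ j ∈ Finset.range n,
          (∫⁻ ω, φ ω ∂P + if n ≤ j + M then ∫⁻ ω, F 1 ω ∂P else 0) := by
        rw [lintegral_finsetSum]
        · refine Finset.sum_congr rfl fun j _ => ?_
          rw [lintegral_add_left (f := fun ω => φ (T^[j] ω)) (hφm.comp (hTm j)), hcomp φ hφm]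
          split_ifs
          · rw [hcomp _ (hF 1)]
          · simp
        · intro j _
          refine (hφm.comp (hTm j)).add ?_
          split_ifs
          · exact (hF 1).comp (hTm j)
          · exact measurable_const
      _ ≤ n * ∫⁻ ω, φ ω ∂P + M * ∫⁻ ω, F 1 ω ∂P := by
        rw [Finset.sum_add_distrib, Finset.sum_const, Finset.card_range, nsmul_eq_mul]
        gcongr
        exact sum_range_ite_le_add_le _ n
  have hempty : ∀ ε, ε ≠ 0 → ⋂ M, A ε M = ∅ := by
    intro ε hε
    refine Set.eq_empty_of_forall_notMem fun ω hω => ?_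
    simp only [Set.mem_iInter] at hω
    by_cases htop : g ω = ⊤
    · exact absurd (hω 1 1 le_rfl le_rfl) (by simp [htop])
    · have hlt : liminf (fun n : ℕ => F n ω / n) atTop < g ω + ε :=
        ENNReal.lt_add_right htop hε
      obtain ⟨n, hn, hn1⟩ := ((frequently_lt_of_liminf_lt (by isBoundedDefault)
        hlt).and_eventually (eventually_ge_atTop 1)).exists
      have h1 := hω n n hn1 le_rfl
      have : F n ω ≤ n * (g ω + ε) := by
        rw [mul_comm]
        exact (ENNReal.div_le_iff (by exact_mod_cast (by omega : n ≠ 0)) (by simp)).1 hn.le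
      exact absurd h1 this.not_gt
  refine ENNReal.le_of_forall_pos_le_add fun ε hε _ => ?_
  have hanti : Antitone (A ε) := fun M N hMN ω hω k h1 h2 => hω k h1 (h2.trans hMN)
  have hlim : Tendsto (fun M => ∫⁻ ω in A ε M, F 1 ω ∂P) atTop (𝓝 0) := by
    refine tendsto_setLIntegral_zero hint ?_
    have := tendsto_measure_iInter_atTop (μ := P) (fun M => (hAm ε M).nullMeasurableSet) hanti
      ⟨0, measure_ne_top _ _⟩
    rwa [hempty ε (by exact_mod_cast hε.ne'), measure_empty] at this
  have hlim' := (tendsto_const_nhds (x := ∫⁻ ω, g ω ∂P + ε)).add hlim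
  rw [add_zero] at hlim'
  exact ge_of_tendsto hlim' ((eventually_ge_atTop 1).mono fun M hM => key ε M hM)

theorem tendsto_natCast_div_div_atTop (m : ℕ) :
    Tendsto (fun n : ℕ => ((n / m : ℕ) : ℝ) / n) atTop (𝓝 (1 / m)) := by
  have := (tendsto_nat_floor_mul_div_atTop (R := ℝ) (a := 1 / m) (by positivity)).comp
    tendsto_natCast_atTop_atTop
  refine this.congr fun n => ?_
  simp only [Function.comp_apply]
  rw [one_div_mul_eq_div, Nat.floor_div_natCast, Nat.floor_natCast]

/-- If the averages of a subadditive array along windows of length `m` converge to `c`, then its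
upper growth rate is at most `c / m`. -/
theorem eventually_div_le_of_tendsto_block_average {a : ℕ → ℕ → ℝ} (h0 : ∀ i, a i 0 = 0)
    (hsub : ∀ i m n, a i (m + n) ≤ a i m + a (i + m) n) {m : ℕ} (hm : 0 < m) {c d : ℝ}
    (hc : Tendsto (fun q : ℕ => (∑ k ∈ Finset.range q, a (m * k) m) / (q : ℝ)) atTop (𝓝 c))
    (hd : Tendsto (fun n : ℕ => (∑ j ∈ Finset.range n, a j 1) / (n : ℝ)) atTop (𝓝 d))
    {e : ℝ} (he : c / m < e) : ∀ᶠ n : ℕ in atTop, a 0 n / n < e := by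
  set S : ℕ → ℝ := fun n => ∑ j ∈ Finset.range n, a j 1
  set B : ℕ → ℝ := fun q => ∑ k ∈ Finset.range q, a (m * k) m
  have hm0 : (m : ℝ) ≠ 0 := by exact_mod_cast hm.ne'
  have hq : Tendsto (fun n : ℕ => n / m) atTop atTop := Nat.tendsto_div_const_atTop hm.ne'
  have hmq : Tendsto (fun n : ℕ => m * (n / m)) atTop atTop :=
    hq.const_mul_atTop' hm
  have hr := tendsto_natCast_div_div_atTop m
  have hlim : Tendsto (fun n : ℕ => ((n / m : ℕ) : ℝ) / n * (B (n / m) / ((n / m : ℕ) : ℝ)) +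
      (S n / n - m * (((n / m : ℕ) : ℝ) / n) * (S (m * (n / m)) / ((m * (n / m) : ℕ) : ℝ))))
      atTop (𝓝 (1 / m * c + (d - m * (1 / m) * d))) :=
    (hr.mul (hc.comp hq)).add (hd.sub ((hr.const_mul _).mul (hd.comp hmq)))
  have hlim_eq : 1 / m * c + (d - m * (1 / m) * d) = c / m := by
    field_simp
    ring
  rw [hlim_eq] at hlim
  filter_upwards [hlim.eventually_lt_const he, eventually_ge_atTop m] with n hn hmn
  refine lt_of_le_of_lt ?_ hn
  have hn0 : (n : ℝ) ≠ 0 := by exact_mod_cast (by omega : n ≠ 0)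
  have hq0 : ((n / m : ℕ) : ℝ) ≠ 0 := by exact_mod_cast (Nat.div_pos hmn hm).ne'
  have hbound : a 0 n ≤ B (n / m) + (S n - S (m * (n / m))) := by
    have h1 := hsub 0 (m * (n / m)) (n % m)
    have h2 := subadditive_array_le_sum_blocks h0 hsub m 0 (n / m)
    have h3 := subadditive_array_le_sum h0 hsub (m * (n / m)) (n % m)
    have h4 : S n = S (m * (n / m)) + ∑ k ∈ Finset.range (n % m), a (m * (n / m) + k) 1 := by
      rw [← Finset.sum_range_add, Nat.div_add_mod]
    rw [Nat.div_add_mod] at h1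
    simp only [zero_add] at h1 h2
    linarith
  calc a 0 n / n ≤ (B (n / m) + (S n - S (m * (n / m)))) / n := by gcongr
    _ = _ := by
      push_cast
      field_simp

/-- Kingman's theorem for nonnegative subadditive processes whose block averages obey the strong
law of large numbers. -/
theorem tendsto_of_subadditive_of_strong_law {Ω : Type*} [MeasurableSpace Ω] {P : Measure Ω}
    [IsProbabilityMeasure P] {T : Ω → Ω} (hT : MeasurePreserving T P P) {f : ℕ → Ω → ℝ}
    (hf : ∀ n, Measurable (f n)) (h0 : ∀ ω, f 0 ω = 0) (hnn : ∀ n ω, 0 ≤ f n ω)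
    (hint1 : Integrable (f 1) P)
    (hsub : ∀ᵐ ω ∂P, ∀ m n, f (m + n) ω ≤ f m ω + f n (T^[m] ω))
    (hlaw : ∀ m, 0 < m → Integrable (f m) P → ∀ᵐ ω ∂P,
      Tendsto (fun q : ℕ => (∑ k ∈ Finset.range q, f m (T^[m * k] ω)) / (q : ℝ)) atTop
        (𝓝 (∫ ω, f m ω ∂P))) :
    (∀ n, Integrable (f n) P) ∧
    ∃ h : ℝ, Tendsto (fun n : ℕ => (∫ ω, f n ω ∂P) / n) atTop (𝓝 h) ∧
      (∀ᵐ ω ∂P, Tendsto (fun n : ℕ => f n ω / n) atTop (𝓝 h)) ∧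
      Tendsto (fun n : ℕ => ∫ ω, |f n ω / n - h| ∂P) atTop (𝓝 0) := by
  have hsub' : ∀ᵐ ω ∂P, ∀ i m n,
      f (m + n) (T^[i] ω) ≤ f m (T^[i] ω) + f n (T^[i + m] ω) := by
    filter_upwards [ae_forall_iterate hT hsub] with ω hω i m n
    simpa [add_comm i m, Function.iterate_add_apply] using hω i m n
  have hcomp : ∀ n j, Integrable (f n) P → Integrable (fun ω => f n (T^[j] ω)) P :=
    fun n j h => ((hT.iterate j).integrable_comp h.aestronglyMeasurable).2 h
  have hint : ∀ n, Integrable (f n) P := by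
    intro n
    refine (integrable_finsetSum (Finset.range n) fun j _ => hcomp 1 j hint1).mono'
      (hf n).aestronglyMeasurable ?_
    filter_upwards [hsub'] with ω hω
    rw [Real.norm_of_nonneg (hnn n ω)]
    simpa using subadditive_array_le_sum (a := fun i n => f n (T^[i] ω)) (fun i => h0 _) hω 0 n
  set u : ℕ → ℝ := fun n => ∫ ω, f n ω ∂P
  have hu0 : ∀ n, 0 ≤ u n := fun n => integral_nonneg (hnn n)
  have hcompint : ∀ n j, ∫ ω, f n (T^[j] ω) ∂P = u n := fun n j => by
    have := integral_map (μ := P) (hT.iterate j).measurable.aemeasurable (f := f n)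
      (hf n).aestronglyMeasurable
    rw [(hT.iterate j).map_eq] at this
    exact this.symm
  have hu : Subadditive u := fun m n => by
    rw [← hcompint n m, ← integral_add (hint m) (hcomp n m (hint n))]
    exact integral_mono_ae (hint _) ((hint m).add (hcomp n m (hint n)))
      (hsub.mono fun ω hω => hω m n)
  have hbdd : BddBelow (Set.range fun n => u n / n) :=
    ⟨0, by rintro _ ⟨n, rfl⟩; exact div_nonneg (hu0 n) n.cast_nonneg⟩
  set h : ℝ := hu.lim
  have hlim : Tendsto (fun n : ℕ => u n / n) atTop (𝓝 h) := hu.tendsto_lim hbdd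
  have hh0 : 0 ≤ h := ge_of_tendsto' hlim fun n => div_nonneg (hu0 n) n.cast_nonneg
  have hupper : ∀ᵐ ω ∂P, ∀ e > h, ∀ᶠ n : ℕ in atTop, f n ω / n < e := by
    have hlaw' : ∀ᵐ ω ∂P, ∀ m, 0 < m → Tendsto
        (fun q : ℕ => (∑ k ∈ Finset.range q, f m (T^[m * k] ω)) / (q : ℝ)) atTop (𝓝 (u m)) := by
      rw [ae_all_iff]
      intro m
      by_cases hm : 0 < m
      · exact (hlaw m hm (hint m)).mono fun ω hω _ => hω
      · exact Eventually.of_forall fun ω hm' => absurd hm' hm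
    filter_upwards [hsub', hlaw'] with ω hω hl e he
    obtain ⟨m, hme, hm⟩ := ((hlim.eventually_lt_const he).and (eventually_gt_atTop 0)).exists
    exact eventually_div_le_of_tendsto_block_average (a := fun i n => f n (T^[i] ω))
      (fun i => h0 _) hω hm (hl m hm) (by simpa using hl 1 one_pos) hme
  have hcast : ∀ {n : ℕ} (ω : Ω), 0 < n →
      ENNReal.ofReal (f n ω) / (n : ℝ≥0∞) = ENNReal.ofReal (f n ω / n) := fun {n} ω hn => by
    rw [ENNReal.ofReal_div_of_pos (by exact_mod_cast hn), ENNReal.ofReal_natCast]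
  have hlower : ENNReal.ofReal h ≤
      ∫⁻ ω, liminf (fun n : ℕ => ENNReal.ofReal (f n ω) / (n : ℝ≥0∞)) atTop ∂P := by
    refine le_lintegral_liminf_of_subadditive hT (F := fun n ω => ENNReal.ofReal (f n ω))
      (fun n => (hf n).ennreal_ofReal) (fun ω => by simp [h0]) (fun ω => by simp) ?_ ?_ ?_
    · rw [← ofReal_integral_eq_lintegral_ofReal hint1 (ae_of_all _ (hnn 1))]
      simp
    · filter_upwards [hsub] with ω hω m n
      rw [← ENNReal.ofReal_add (hnn _ _) (hnn _ _)]
      exact ENNReal.ofReal_le_ofReal (hω m n)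
    · intro n
      rw [← ofReal_integral_eq_lintegral_ofReal (hint n) (ae_of_all _ (hnn n)),
        ← ENNReal.ofReal_natCast, ← ENNReal.ofReal_mul n.cast_nonneg]
      refine ENNReal.ofReal_le_ofReal ?_
      rcases Nat.eq_zero_or_pos n with rfl | hn
      · simpa using hu0 0
      · have := hu.lim_le_div hbdd hn.ne'
        rwa [le_div_iff₀' (by exact_mod_cast hn)] at this
  have hle : ∀ᵐ ω ∂P,
      liminf (fun n : ℕ => ENNReal.ofReal (f n ω) / (n : ℝ≥0∞)) atTop ≤ ENNReal.ofReal h := by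
    filter_upwards [hupper] with ω hω
    refine ENNReal.le_of_forall_pos_le_add fun ε hε _ => ?_
    refine liminf_le_of_frequently_le' (Eventually.frequently ?_)
    filter_upwards [hω (h + ε) (by simpa using hε), eventually_gt_atTop 0] with n hn hn0
    rw [hcast ω hn0, ← ENNReal.ofReal_coe_nnreal, ← ENNReal.ofReal_add hh0 ε.coe_nonneg]
    exact ENNReal.ofReal_le_ofReal hn.le
  have heq := ae_eq_of_ae_le_of_lintegral_le hle
    (ne_top_of_le_ne_top (by simp : ∫⁻ _, ENNReal.ofReal h ∂P ≠ ⊤) (lintegral_mono_ae hle))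
    aemeasurable_const (by simpa using hlower)
  have hae : ∀ᵐ ω ∂P, Tendsto (fun n : ℕ => f n ω / n) atTop (𝓝 h) := by
    filter_upwards [hupper, heq] with ω hω hg
    refine tendsto_order.2 ⟨fun c hc => ?_, hω⟩
    rcases lt_or_ge c 0 with hc0 | hc0
    · exact Eventually.of_forall fun n => hc0.trans_le (div_nonneg (hnn n ω) n.cast_nonneg)
    · have hlt : ENNReal.ofReal c <
          liminf (fun n : ℕ => ENNReal.ofReal (f n ω) / (n : ℝ≥0∞)) atTop := by
        rw [hg]
        exact (ENNReal.ofReal_lt_ofReal_iff_of_nonneg hc0).2 hc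
      filter_upwards [eventually_lt_of_lt_liminf hlt (by isBoundedDefault),
        eventually_gt_atTop 0] with n hn hn0
      rw [hcast ω hn0] at hn
      exact (ENNReal.ofReal_lt_ofReal_iff_of_nonneg hc0).1 hn
  refine ⟨hint, h, hlim, hae, ?_⟩
  have hintd : ∀ n : ℕ, Integrable (fun ω => f n ω / n) P := fun n => (hint n).div_const _
  have hneg : Tendsto (fun n : ℕ => ∫ ω, max (h - f n ω / n) 0 ∂P) atTop (𝓝 0) := by
    have := tendsto_integral_of_dominated_convergence (μ := P)
      (F := fun (n : ℕ) ω => max (h - f n ω / n) 0) (f := fun _ => 0) (fun _ => h)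
      (fun n => ((((hf n).div_const _).const_sub h).max measurable_const).aestronglyMeasurable)
      (integrable_const _) (fun n => ae_of_all _ fun ω => ?_) (hae.mono fun ω hω => ?_)
    · simpa using this
    · rw [Real.norm_of_nonneg (le_max_right _ _)]
      have : 0 ≤ f n ω / n := div_nonneg (hnn n ω) n.cast_nonneg
      exact max_le (by linarith) hh0
    · simpa using (hω.const_sub h).max (tendsto_const_nhds (x := (0 : ℝ)))
  have hformula : ∀ n : ℕ, ∫ ω, |f n ω / n - h| ∂P =
      u n / n - h + 2 * ∫ ω, max (h - f n ω / n) 0 ∂P := fun n => by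
    have habs : ∀ ω, |f n ω / n - h| = f n ω / n - h + 2 * max (h - f n ω / n) 0 := fun ω => by
      rcases le_total h (f n ω / n) with hle | hle
      · rw [abs_of_nonneg (by linarith), max_eq_right (by linarith)]
        ring
      · rw [abs_of_nonpos (by linarith), max_eq_left (by linarith)]
        ring
    have hmax : Integrable (fun ω => max (h - f n ω / n) 0) P :=
      ((integrable_const h).sub (hintd n)).pos_part
    simp_rw [habs]
    rw [integral_add (f := fun ω => f n ω / n - h) ((hintd n).sub (integrable_const h)) (hmax.const_mul 2),
      integral_sub (hintd n) (integrable_const h), integral_const_mul, integral_div]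
    simp [u]
  simp_rw [hformula]
  simpa using (hlim.sub_const h).add (hneg.const_mul 2)

/-- The left shift on sequences. -/
def seqShift {α : Type*} (ω : ℕ → α) : ℕ → α := fun i => ω (i + 1)

theorem seqShift_iterate_apply {α : Type*} (m : ℕ) (ω : ℕ → α) (i : ℕ) :
    seqShift^[m] ω i = ω (m + i) := by
  induction m generalizing i with
  | zero => simp
  | succ m ih =>
    rw [Function.iterate_succ_apply', seqShift, ih]
    congr 1
    omega

theorem measurePreserving_seqShift {α : Type*} [MeasurableSpace α] (ν : Measure α)
    [IsProbabilityMeasure ν] :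
    MeasurePreserving (seqShift (α := α)) (Measure.infinitePi fun _ => ν)
      (Measure.infinitePi fun _ => ν) :=
  ⟨measurable_pi_lambda _ fun i => measurable_pi_apply (i + 1),
    Measure.map_infinitePi_infinitePi_of_inj (P := fun _ : ℕ => ν) (add_left_injective 1)⟩

/-- A measure on sequences in a countable space is determined by its values on initial cylinders:
product values force it to be the product measure. -/
theorem eq_infinitePi_of_cylinders {G : Type*} [Countable G] [MeasurableSpace G]
    [DiscreteMeasurableSpace G] (ν : Measure G) [IsProbabilityMeasure ν] (P : Measure (ℕ → G))
    (hP : ∀ (n : ℕ) (g : ℕ → G), P {ω | ∀ i < n, ω i = g i} = ∏ i ∈ Finset.range n, ν {g i}) :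
    P = Measure.infinitePi fun _ => ν := by
  classical
  refine Measure.eq_infinitePi (fun _ : ℕ => ν) fun s t ht => ?_
  obtain ⟨n, hn⟩ := s.exists_nat_subset_range
  set r : (ℕ → G) → (Fin n → G) := fun ω i => ω i
  have hr : Measurable r := measurable_pi_lambda _ fun i => measurable_pi_apply _
  obtain ⟨ω₀⟩ : Nonempty G := Measure.nonempty_of_neZero ν
  have hmap : P.map r = Measure.pi fun _ => ν := by
    refine Measure.ext_of_singleton fun x => ?_
    rw [Measure.map_apply hr (measurableSet_singleton x), Measure.pi_singleton]
    have := hP n fun i => if h : i < n then x ⟨i, h⟩ else ω₀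
    rw [Finset.prod_range] at this
    simp only [Fin.is_lt, dite_true, Fin.eta] at this
    rw [← this]
    congr 1
    ext ω
    simp only [Set.mem_preimage, Set.mem_singleton_iff, funext_iff, Fin.forall_iff,
      Set.mem_ofPred_eq, r]
    exact forall₂_congr fun i hi => by rw [dif_pos hi]
  have hpre : (s : Set ℕ).pi t =
      r ⁻¹' Set.univ.pi fun i : Fin n => if (i : ℕ) ∈ s then t i else Set.univ := by
    ext ω
    simp only [Set.mem_pi, Set.mem_preimage, Set.mem_univ, true_imp_iff, r, Fin.forall_iff,
      Finset.mem_coe]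
    refine ⟨fun h i _ => ?_, fun h i hi => ?_⟩
    · split_ifs with hi
      exacts [h i hi, Set.mem_univ _]
    · simpa [hi] using h i (Finset.mem_range.1 (hn hi))
  rw [hpre, ← Measure.map_apply hr (MeasurableSet.of_discrete), hmap, Measure.pi_pi]
  simp only [apply_ite ν, measure_univ]
  rw [← Finset.prod_range fun i => if i ∈ s then ν (t i) else 1, Finset.prod_ite_mem,
    Finset.inter_eq_right.2 hn]

theorem rwPos_zero {G : Type*} [Group G] (ω : ℕ → G) : rwPos ω 0 = 1 := by simp [rwPos]

theorem rwPos_succ {G : Type*} [Group G] (ω : ℕ → G) (n : ℕ) :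
    rwPos ω (n + 1) = rwPos ω n * ω n :=
  List.prod_range_succ ω n

theorem rwPos_congr {G : Type*} [Group G] {ω ω' : ℕ → G} {n : ℕ} (h : ∀ i < n, ω i = ω' i) :
    rwPos ω n = rwPos ω' n := by
  induction n with
  | zero => simp [rwPos_zero]
  | succ n ih =>
    rw [rwPos_succ, rwPos_succ, ih fun i hi => h i (by omega), h n (by omega)]

theorem rwPos_add {G : Type*} [Group G] (ω : ℕ → G) (m n : ℕ) :
    rwPos ω (m + n) = rwPos ω m * rwPos (seqShift^[m] ω) n := by
  induction n with
  | zero => simp [rwPos_zero]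
  | succ n ih =>
    rw [← add_assoc, rwPos_succ, ih, rwPos_succ, seqShift_iterate_apply, mul_assoc]

theorem measurable_rwPos {G : Type*} [Group G] [Countable G] [MeasurableSpace G]
    [DiscreteMeasurableSpace G] (n : ℕ) : Measurable fun ω : ℕ → G => rwPos ω n := by
  induction n with
  | zero => simp [rwPos_zero]
  | succ n ih =>
    simp_rw [rwPos_succ]
    exact (Measurable.of_discrete (f := fun p : G × G => p.1 * p.2)).comp
      (ih.prodMk (measurable_pi_apply n))

theorem fconvPow_one {G : Type*} [Group G] (f : G → ℝ≥0∞) : fconvPow f 1 = f := by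
  classical
  ext x
  simp only [fconvPow, fconv, ite_mul, one_mul, zero_mul]
  rw [tsum_eq_single 1 fun y hy => if_neg hy]
  simp

theorem fconvPow_mul_le {G : Type*} [Group G] (f : G → ℝ≥0∞) (m n : ℕ) (x y : G) :
    fconvPow f m x * fconvPow f n y ≤ fconvPow f (m + n) (x * y) := by
  induction n generalizing y with
  | zero =>
    simp only [fconvPow, add_zero]
    split_ifs with hy
    · simp [hy]
    · simp
  | succ n ih =>
    rw [← add_assoc]
    simp only [fconvPow, fconv]
    rw [← ENNReal.tsum_mul_left,
      ← (Equiv.mulLeft x).tsum_eq fun k => fconvPow f (m + n) k * f (k⁻¹ * (x * y))]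
    refine ENNReal.tsum_le_tsum fun k => ?_
    simp only [Equiv.coe_mulLeft, mul_inv_rev, mul_assoc, inv_mul_cancel_left]
    rw [← mul_assoc]
    gcongr
    exact ih k

section ProductMeasure

open ProbabilityTheory

variable {G : Type*} [Group G] [Countable G] [MeasurableSpace G] [DiscreteMeasurableSpace G]
  (ν : Measure G) [IsProbabilityMeasure ν]

/-- Positions over disjoint time windows are independent. -/
theorem indepFun_rwPos_iterate_seqShift {s t m n : ℕ}
    (h : Disjoint (Finset.Ico s (s + m)) (Finset.Ico t (t + n))) :
    IndepFun (fun ω : ℕ → G => rwPos (seqShift^[s] ω) m)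
      (fun ω : ℕ → G => rwPos (seqShift^[t] ω) n) (Measure.infinitePi fun _ => ν) := by
  have hind := (iIndepFun_infinitePi (P := fun _ : ℕ => ν) (X := fun _ g => g)
    fun _ => measurable_id).indepFun_finset _ _ h fun i => measurable_pi_apply i
  set ψ : ∀ s m, (Finset.Ico s (s + m) → G) → G := fun s m x =>
    rwPos (fun j => if hj : s + j ∈ Finset.Ico s (s + m) then x ⟨s + j, hj⟩ else 1) m
  have hψ : ∀ s m (ω : ℕ → G), ψ s m (fun i => ω i) = rwPos (seqShift^[s] ω) m := fun s m ω =>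
    rwPos_congr fun i hi => by
      rw [dif_pos (by simpa using hi), seqShift_iterate_apply]
  simpa only [Function.comp_def, hψ] using
    hind.comp (measurable_of_countable (ψ s m)) (measurable_of_countable (ψ t n))

/-- The law of the position after `n` steps is the `n`-fold convolution power. -/
theorem map_rwPos_singleton (n : ℕ) (g : G) :
    (Measure.infinitePi fun _ : ℕ => ν).map (fun ω => rwPos ω n) {g} =
      fconvPow (fun x => ν {x}) n g := by
  classical
  induction n generalizing g with
  | zero =>
    simp only [rwPos_zero, fconvPow, Measure.map_const, measure_univ, one_smul]
    rw [Measure.dirac_apply' _ (measurableSet_singleton g)]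
    simp [Set.indicator_apply, eq_comm]
  | succ n ih =>
    set P := Measure.infinitePi fun _ : ℕ => ν
    have hind : IndepFun (fun ω : ℕ → G => rwPos ω n) (fun ω => ω n) P := by
      simpa [rwPos_succ, rwPos_zero, seqShift_iterate_apply] using
        indepFun_rwPos_iterate_seqShift ν (s := 0) (m := n) (t := n) (n := 1)
          (by simp [Finset.disjoint_left]; omega)
    have hpair := (indepFun_iff_map_prod_eq_prod_map_map (measurable_rwPos n).aemeasurable
      (measurable_pi_apply n).aemeasurable).1 hind
    have hmul : Measurable fun p : G × G => p.1 * p.2 := Measurable.of_discrete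
    have hmap : P.map (fun ω => rwPos ω (n + 1)) =
        ((P.map fun ω => rwPos ω n).prod ν).map fun p => p.1 * p.2 := by
      rw [Measure.infinitePi_map_eval (fun _ : ℕ => ν) n] at hpair
      rw [← hpair, Measure.map_map hmul ((measurable_rwPos n).prodMk (measurable_pi_apply n))]
      simp only [Function.comp_def, rwPos_succ]
    rw [hmap, Measure.map_apply hmul (measurableSet_singleton g),
      Measure.prod_apply (hmul (measurableSet_singleton g)), lintegral_countable']
    simp only [fconvPow, fconv, ← ih]
    refine tsum_congr fun k => ?_
    rw [mul_comm]
    congr 2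
    ext y
    simp [eq_inv_mul_iff_mul_eq]

theorem fconvPow_le_one (n : ℕ) (g : G) : fconvPow (fun x => ν {x}) n g ≤ 1 := by
  have := Measure.isProbabilityMeasure_map (μ := Measure.infinitePi fun _ : ℕ => ν)
    (measurable_rwPos (G := G) n).aemeasurable
  rw [← map_rwPos_singleton]
  exact prob_le_one

theorem ae_fconvPow_rwPos_ne_zero :
    ∀ᵐ ω ∂(Measure.infinitePi fun _ : ℕ => ν), ∀ n,
      fconvPow (fun x => ν {x}) n (rwPos ω n) ≠ 0 := by
  refine ae_all_iff.2 fun n => ?_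
  refine ae_of_ae_map (measurable_rwPos n).aemeasurable
    (p := fun g => fconvPow (fun x => ν {x}) n g ≠ 0) ?_
  refine ae_iff_of_countable.2 fun g hg => ?_
  rwa [map_rwPos_singleton] at hg

/-- Shannon's theorem on the product space of increments, for the information function
`-log μ^{*n}(x_n)`. -/
theorem shannon_theorem_infinitePi
    (hent : Summable fun g : G => (ν {g}).toReal * Real.log (ν {g}).toReal) :
    ∃ h : ℝ,
      Tendsto (fun n : ℕ => fent (fconvPow (fun x => ν {x}) n) / (n : ℝ)) atTop (𝓝 h) ∧
      (∀ᵐ ω ∂(Measure.infinitePi fun _ : ℕ => ν), Tendsto (fun n : ℕ =>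
        -Real.log ((fconvPow (fun x => ν {x}) n (rwPos ω n)).toReal) / (n : ℝ)) atTop (𝓝 h)) ∧
      Tendsto (fun n : ℕ => ∫ ω,
          |-Real.log ((fconvPow (fun x => ν {x}) n (rwPos ω n)).toReal) / (n : ℝ) - h|
            ∂(Measure.infinitePi fun _ : ℕ => ν)) atTop (𝓝 0) := by
  set P := Measure.infinitePi fun _ : ℕ => ν
  set p : ℕ → G → ℝ≥0∞ := fconvPow fun x => ν {x}
  set φ : ℕ → G → ℝ := fun n g => -Real.log (p n g).toReal
  have hple : ∀ n g, p n g ≤ 1 := fconvPow_le_one ν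
  have hptop : ∀ n g, p n g ≠ ⊤ := fun n g => ne_top_of_le_ne_top ENNReal.one_ne_top (hple n g)
  have hT : MeasurePreserving (seqShift (α := G)) P P := measurePreserving_seqShift ν
  have hφ : ∀ n, Measurable (φ n) := fun n => Measurable.of_discrete
  have hnn : ∀ n g, 0 ≤ φ n g := fun n g => neg_nonneg.2
    (Real.log_nonpos ENNReal.toReal_nonneg (ENNReal.toReal_le_of_le_ofReal zero_le_one
      (by simpa using hple n g)))
  have hf : ∀ n, Measurable fun ω : ℕ → G => φ n (rwPos ω n) := fun n =>
    (hφ n).comp (measurable_rwPos n)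
  have hmap : ∀ n g, (P.map fun ω => rwPos ω n) {g} = p n g := map_rwPos_singleton ν
  have hint1 : Integrable (fun ω => φ 1 (rwPos ω 1)) P := by
    have : Integrable (φ 1) (P.map fun ω => rwPos ω 1) := by
      refine ⟨(hφ 1).aestronglyMeasurable, ?_⟩
      rw [HasFiniteIntegral, lintegral_countable', lt_top_iff_ne_top]
      convert hent.neg.tsum_ofReal_ne_top using 3 with g
      rw [hmap, Real.enorm_of_nonneg (hnn 1 g), ← ENNReal.ofReal_toReal (hptop 1 g),
        ← ENNReal.ofReal_mul (hnn 1 g)]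
      simp only [φ, p, fconvPow_one]
      ring_nf
    exact this.comp_measurable (measurable_rwPos 1)
  have hint_eq : ∀ n, Integrable (fun ω => φ n (rwPos ω n)) P →
      ∫ ω, φ n (rwPos ω n) ∂P = fent (p n) := fun n hn => by
    have hφm := (hφ n).aestronglyMeasurable (μ := P.map fun ω => rwPos ω n)
    rw [← integral_map (φ := fun ω => rwPos ω n) (measurable_rwPos n).aemeasurable hφm,
      integral_countable ((integrable_map_measure hφm (measurable_rwPos n).aemeasurable).2 hn),
      fent, ← tsum_neg]
    refine tsum_congr fun g => ?_
    rw [measureReal_def, hmap, smul_eq_mul, mul_neg]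
  have hsub : ∀ᵐ ω ∂P, ∀ m n, φ (m + n) (rwPos ω (m + n)) ≤
      φ m (rwPos ω m) + φ n (rwPos (seqShift^[m] ω) n) := by
    filter_upwards [ae_forall_iterate hT (ae_fconvPow_rwPos_ne_zero ν)] with ω hω m n
    have h1 : 0 < (p m (rwPos ω m)).toReal := ENNReal.toReal_pos (hω 0 m) (hptop _ _)
    have h2 : 0 < (p n (rwPos (seqShift^[m] ω) n)).toReal :=
      ENNReal.toReal_pos (hω m n) (hptop _ _)
    have hle : (p m (rwPos ω m)).toReal * (p n (rwPos (seqShift^[m] ω) n)).toReal ≤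
        (p (m + n) (rwPos ω (m + n))).toReal := by
      rw [← ENNReal.toReal_mul, rwPos_add]
      exact ENNReal.toReal_mono (hptop _ _) (fconvPow_mul_le _ _ _ _ _)
    have := Real.log_le_log (mul_pos h1 h2) hle
    rw [Real.log_mul h1.ne' h2.ne'] at this
    simp only [φ]
    linarith
  have hlaw : ∀ m, 0 < m → Integrable (fun ω => φ m (rwPos ω m)) P → ∀ᵐ ω ∂P,
      Tendsto (fun q : ℕ => (∑ k ∈ Finset.range q, φ m (rwPos (seqShift^[m * k] ω) m)) / (q : ℝ))
        atTop (𝓝 (∫ ω, φ m (rwPos ω m) ∂P)) := by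
    intro m hm hi
    refine strong_law_ae_real (fun k ω => φ m (rwPos (seqShift^[m * k] ω) m)) (by simpa using hi)
      (fun k l hkl => ?_) fun k => ?_
    · refine (indepFun_rwPos_iterate_seqShift ν ?_).comp (hφ m) (hφ m)
      rw [Finset.disjoint_left]
      intro i hk hl
      rw [Finset.mem_Ico] at hk hl
      refine hkl ?_
      rw [← Nat.div_eq_of_lt_le (m := i) (n := m) (k := k), Nat.div_eq_of_lt_le] <;> lia
    · refine ⟨((hf m).comp (hT.iterate _).measurable).aemeasurable,
        by simpa using (hf m).aemeasurable, ?_⟩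
      have := Measure.map_map (μ := P) (hf m) (hT.iterate (m * k)).measurable
      rw [(hT.iterate (m * k)).map_eq] at this
      simpa [Function.comp_def] using this.symm
  obtain ⟨hint, h, hmean, hae, hL1⟩ := tendsto_of_subadditive_of_strong_law hT (f := fun n ω => φ n (rwPos ω n)) hf
    (fun ω => by simp [φ, p, fconvPow, rwPos_zero]) (fun n ω => hnn n _) hint1 hsub hlaw
  exact ⟨h, hmean.congr fun n => by rw [hint_eq n (hint n)], hae, hL1⟩

end ProductMeasure

/-- Shannon's theorem: for `P`-a.e. sample path, `(1/n) log μ^{*n}(x_n) → -h(μ)`,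
and the convergence also holds in `L¹(P)`. -/
theorem shannon_theorem_random_walk
    {G : Type*} [Group G] [Countable G] [MeasurableSpace G] [DiscreteMeasurableSpace G]
    (μf : G → ℝ≥0∞) (hprob : ∑' g : G, μf g = 1)
    (hent : Summable fun g : G => (μf g).toReal * Real.log (μf g).toReal)
    (P : Measure (ℕ → G)) [IsProbabilityMeasure P]
    (hP : ∀ (n : ℕ) (g : ℕ → G),
      P {ω | ∀ i < n, ω i = g i} = ∏ i ∈ Finset.range n, μf (g i)) :
    ∃ h : ℝ,
      Tendsto (fun n : ℕ => fent (fconvPow μf n) / (n : ℝ)) atTop (𝓝 h) ∧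
      (∀ᵐ ω ∂P,
        Tendsto (fun n : ℕ => Real.log ((fconvPow μf n (rwPos ω n)).toReal) / (n : ℝ))
          atTop (𝓝 (-h))) ∧
      Tendsto (fun n : ℕ =>
          ∫ ω, |Real.log ((fconvPow μf n (rwPos ω n)).toReal) / (n : ℝ) - (-h)| ∂P)
        atTop (𝓝 0) := by
  set ν : Measure G := PMF.toMeasure ⟨μf, hprob ▸ ENNReal.summable.hasSum⟩
  have : IsProbabilityMeasure ν := PMF.toMeasure.isProbabilityMeasure _
  have hν : ∀ g, ν {g} = μf g := fun g =>
    PMF.toMeasure_apply_singleton _ g (measurableSet_singleton g)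
  obtain rfl : P = Measure.infinitePi fun _ => ν :=
    eq_infinitePi_of_cylinders ν P (by simpa only [hν] using hP)
  obtain ⟨h, hmean, hae, hL1⟩ := shannon_theorem_infinitePi ν (by simpa only [hν] using hent)
  simp only [hν] at hmean hae hL1
  refine ⟨h, hmean, hae.mono fun ω hω => ?_, hL1.congr fun n => integral_congr_ae ?_⟩
  · simpa only [neg_div, neg_neg] using hω.neg
  · refine ae_of_all _ fun ω => ?_
    dsimp only
    rw [← abs_neg]
    congr 1
    ring
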